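/- Let k ≥ 3 be an integer and let c > 0 be a constant such that every weakly-(k−1)-cross-free family on any finite ground set of size m ≥ 1 has at most c·m members. Let X be a finite set of size n ≥ 1 and let F ⊆ 2^X be a weakly-k-cross-free family. Then the number of exceptional sets in F, i.e. sets A ∈ F for which there exist distinct x, y ∈ X \ A with A ∪ {x} ∈ F and A ∪ {y} ∈ F, is at most k·c·n + k·n. -/

import Mathlib

open Finset

/-- Two subsets `A` and `B` are weakly-crossing if none of the three sets
`A ∩ B`, `A \ B`, `B \ A` is empty. -/
def WeaklyCrossing {α : Type*} [DecidableEq α] (A B : Finset α) : Prop :=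
  (A ∩ B).Nonempty ∧ (A \ B).Nonempty ∧ (B \ A).Nonempty

/-- A family is weakly-`k`-cross-free if it contains no `k` members that are
pairwise weakly-crossing. -/
def WeaklyCrossFreeFam {α : Type*} [DecidableEq α] (k : ℕ)
    (F : Finset (Finset α)) : Prop :=
  ¬ ∃ S : Finset (Finset α), S ⊆ F ∧ S.card = k ∧
      (S : Set (Finset α)).Pairwise WeaklyCrossing

/-- In a weakly-`k`-cross-free family, pairwise weakly-crossing subfamilies have fewer than `k`
members. -/
theorem WeaklyCrossFreeFam.card_lt {α : Type*} [DecidableEq α] {k : ℕ}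
    {F S : Finset (Finset α)} (hF : WeaklyCrossFreeFam k F) (hS : S ⊆ F)
    (hc : (S : Set (Finset α)).Pairwise WeaklyCrossing) : S.card < k := by
  by_contra! h
  obtain ⟨R, hR, hRk⟩ := Finset.exists_subset_card_eq h
  exact hF ⟨R, hR.trans hS, hRk, hc.mono (by exact_mod_cast hR)⟩

theorem WeaklyCrossing.symm {α : Type*} [DecidableEq α] {A B : Finset α}
    (h : WeaklyCrossing A B) : WeaklyCrossing B A :=
  ⟨by rw [Finset.inter_comm]; exact h.1, h.2.2, h.2.1⟩

/-- Distinct intersecting sets of the same size are weakly-crossing. -/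
theorem weaklyCrossing_of_card_eq {α : Type*} [DecidableEq α] {A B : Finset α}
    (hne : A ≠ B) (hcard : A.card = B.card) (hi : (A ∩ B).Nonempty) :
    WeaklyCrossing A B :=
  ⟨hi, Finset.sdiff_nonempty.2 fun h => hne (Finset.eq_of_subset_of_card_le h hcard.ge),
    Finset.sdiff_nonempty.2 fun h => hne (Finset.eq_of_subset_of_card_le h hcard.le).symm⟩

/-- Regard `N a` as the pair of endpoints of an edge `a`. A graph with edge set `E` and maximum
degree at most `d` has a forest `E'` with at least `|E| / d` edges, a forest being characterised by
each nonempty set of its edges covering more vertices than it has members. -/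
theorem exists_forest_of_degree_le {ι τ : Type*} [DecidableEq ι] [DecidableEq τ]
    (E : Finset ι) (N : ι → Finset τ) (d : ℕ) (hN : ∀ a ∈ E, (N a).card = 2)
    (hd : ∀ t, (E.filter (fun a => t ∈ N a)).card ≤ d) :
    ∃ E' ⊆ E, (∀ S ⊆ E', S.Nonempty → S.card + 1 ≤ (S.biUnion N).card) ∧
      E.card ≤ d * E'.card := by
  let P : Finset ι → Prop := fun E' => ∀ S ⊆ E', S.Nonempty → S.card + 1 ≤ (S.biUnion N).card
  have hne : ∃ E', E' ⊆ E ∧ P E' := by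
    refine ⟨∅, Finset.empty_subset _, fun S hS hS' => ?_⟩
    simp [Finset.subset_empty.1 hS] at hS'
  have hfin : {E' | E' ⊆ E ∧ P E'}.Finite :=
    (E.powerset.finite_toSet).subset fun E' h => by simpa using h.1
  obtain ⟨E', hmax⟩ := hfin.exists_maximal hne
  obtain ⟨hE', hP⟩ := hmax.prop
  refine ⟨E', hE', hP, ?_⟩
  have hcover : ∀ a ∈ E, N a ⊆ E'.biUnion N := by
    intro a ha t ht
    by_contra hcon
    have haE' : a ∉ E' := fun h => hcon (Finset.mem_biUnion.2 ⟨a, h, ht⟩)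
    have hbig : insert a E' ⊆ E ∧ P (insert a E') := by
      refine ⟨Finset.insert_subset ha hE', fun S hS hSne => ?_⟩
      by_cases haS : a ∈ S
      · have hS' : S.erase a ⊆ E' := Finset.subset_insert_iff.1 hS
        rcases (S.erase a).eq_empty_or_nonempty with h0 | h0
        · have : S = {a} := by
            rw [← Finset.insert_erase haS, h0]; rfl
          simp [this, hN a ha]
        · have h1 := hP _ hS' h0
          have h2 : insert t ((S.erase a).biUnion N) ⊆ S.biUnion N :=
            Finset.insert_subset (Finset.mem_biUnion.2 ⟨a, haS, ht⟩)
              (Finset.biUnion_subset_biUnion_of_subset_left _ (Finset.erase_subset _ _))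
          have h3 : t ∉ (S.erase a).biUnion N := fun h =>
            hcon (Finset.biUnion_subset_biUnion_of_subset_left _ hS' h)
          have h4 := Finset.card_le_card h2
          rw [Finset.card_insert_of_notMem h3] at h4
          have h5 := Finset.card_erase_add_one haS
          omega
      · exact hP S ((Finset.subset_insert_iff_of_notMem haS).1 hS) hSne
    exact haE' (hmax.le_of_ge hbig (Finset.subset_insert _ _) (Finset.mem_insert_self _ _))
  have hcount : 2 * E.card ≤ d * (E'.biUnion N).card := by
    have h := Finset.sum_card_bipartiteAbove_eq_sum_card_bipartiteBelow
      (s := E) (t := E'.biUnion N) (fun a t => t ∈ N a)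
    have h1 : ∀ a ∈ E, (Finset.bipartiteAbove (fun a t => t ∈ N a) (E'.biUnion N) a).card = 2 := by
      intro a ha
      rw [← hN a ha]
      congr 1
      ext t
      simp only [Finset.mem_bipartiteAbove]
      exact ⟨fun h => h.2, fun h => ⟨hcover a ha h, h⟩⟩
    rw [Finset.sum_congr rfl h1, Finset.sum_const, smul_eq_mul] at h
    have h2 := Finset.sum_le_card_nsmul (E'.biUnion N)
      (fun t => (Finset.bipartiteBelow (fun a t => t ∈ N a) E t).card) d (fun t _ => hd t)
    rw [smul_eq_mul] at h2
    nlinarith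
  have hle : (E'.biUnion N).card ≤ E'.card * 2 :=
    Finset.card_biUnion_le_card_mul _ _ _ fun a ha => (hN a (hE' ha)).le
  nlinarith [Nat.mul_le_mul_left d hle]

/-- If every member `A` of `E` has a set `N A` of one-element extensions in `F`, and nonempty
subfamilies of `E` have more extensions than members, then passing from `F` to `E` lowers the size
of the largest pairwise weakly-crossing subfamily. -/
theorem weaklyCrossFreeFam_pred {α : Type*} [DecidableEq α] {k : ℕ} (hk : 2 ≤ k)
    {F E : Finset (Finset α)} (hF : WeaklyCrossFreeFam k F) (hEF : E ⊆ F)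
    (hE0 : ∀ A ∈ E, A.Nonempty) (N : Finset α → Finset (Finset α))
    (hN : ∀ A ∈ E, ∀ T ∈ N A, T ∈ F ∧ A ⊆ T ∧ T.card = A.card + 1)
    (hcard : ∀ S ⊆ E, S.Nonempty → S.card + 1 ≤ (S.biUnion N).card) :
    WeaklyCrossFreeFam (k - 1) E := by
  rintro ⟨S, hSE, hSk, hS⟩
  have hSne : S.Nonempty := Finset.card_pos.1 (by omega)
  obtain ⟨M, hMS, hM⟩ := Finset.exists_min_image S Finset.card hSne
  set S₀ := S.filter (fun A => A.card = M.card) with hS₀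
  have hS₀S : S₀ ⊆ S := Finset.filter_subset _ _
  have hext : ∀ T ∈ S₀.biUnion N, ∃ A ∈ S, T ∈ F ∧ A ⊆ T ∧ A.card = M.card ∧
      T.card = M.card + 1 := by
    intro T hT
    obtain ⟨A, hA, hTA⟩ := Finset.mem_biUnion.1 hT
    obtain ⟨hAS, hAM⟩ := Finset.mem_filter.1 hA
    obtain ⟨h1, h2, h3⟩ := hN A (hSE hAS) T hTA
    exact ⟨A, hAS, h1, h2, hAM, by omega⟩
  have hnotS : ∀ T ∈ S₀.biUnion N, T ∉ S := by
    intro T hT hTS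
    obtain ⟨A, hAS, -, hAT, hA, hTc⟩ := hext T hT
    have hne : A ≠ T := by rintro rfl; omega
    exact Finset.sdiff_nonempty.1 (hS hAS hTS hne).2.1 hAT
  have hdisj : Disjoint (S \ S₀) (S₀.biUnion N) :=
    Finset.disjoint_left.2 fun T hT hT' => hnotS T hT' (Finset.mem_sdiff.1 hT).1
  have hmixed : ∀ T ∈ S₀.biUnion N, ∀ B ∈ S \ S₀, WeaklyCrossing T B := by
    intro T hT B hB
    obtain ⟨A, hAS, -, hAT, hA, hTc⟩ := hext T hT
    obtain ⟨hBS, hB0⟩ := Finset.mem_sdiff.1 hB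
    have hBc : B.card ≠ M.card := fun h => hB0 (Finset.mem_filter.2 ⟨hBS, h⟩)
    have hBM := hM B hBS
    have hne : A ≠ B := by rintro rfl; exact hBc hA
    obtain ⟨h1, h2, -⟩ := hS hAS hBS hne
    refine ⟨h1.mono (Finset.inter_subset_inter_right hAT),
      h2.mono (Finset.sdiff_subset_sdiff hAT subset_rfl), Finset.sdiff_nonempty.2 fun h => ?_⟩
    have : B = T := Finset.eq_of_subset_of_card_le h (by omega)
    exact hnotS T hT (this ▸ hBS)
  have hupper : ∀ T ∈ S₀.biUnion N, ∀ T' ∈ S₀.biUnion N, T ≠ T' → WeaklyCrossing T T' := by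
    intro T hT T' hT' hne
    obtain ⟨A, hAS, -, hAT, -, hTc⟩ := hext T hT
    obtain ⟨A', hAS', -, hAT', -, hTc'⟩ := hext T' hT'
    refine weaklyCrossing_of_card_eq hne (by omega) ?_
    have hi : (A ∩ A').Nonempty := by
      rcases eq_or_ne A A' with rfl | h
      · simpa using hE0 A (hSE hAS)
      · exact (hS hAS hAS' h).1
    exact hi.mono (Finset.inter_subset_inter hAT hAT')
  have hlt : ((S \ S₀) ∪ S₀.biUnion N).card < k := by
    refine hF.card_lt (Finset.union_subset ((Finset.sdiff_subset.trans hSE).trans hEF) ?_) ?_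
    · intro T hT
      obtain ⟨A, -, h, -⟩ := hext T hT
      exact h
    · intro B hB B' hB' hne
      rcases Finset.mem_union.1 (Finset.mem_coe.1 hB) with h | h <;>
        rcases Finset.mem_union.1 (Finset.mem_coe.1 hB') with h' | h'
      · exact hS (Finset.mem_sdiff.1 h).1 (Finset.mem_sdiff.1 h').1 hne
      · exact (hmixed B' h' B h).symm
      · exact hmixed B h B' h'
      · exact hupper B h B' h' hne
  have hgain := hcard S₀ (hS₀S.trans hSE) ⟨M, Finset.mem_filter.2 ⟨hMS, rfl⟩⟩
  rw [Finset.card_union_of_disjoint hdisj] at hlt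
  have := Finset.card_sdiff_add_card_eq_card hS₀S
  omega

/-- Members of `F` of size at least two obtained from `T` by deleting one element are pairwise
weakly-crossing, so there are fewer than `k` of them. -/
theorem WeaklyCrossFreeFam.card_lt_of_shadow {α : Type*} [DecidableEq α] {k : ℕ}
    {F S : Finset (Finset α)} (hF : WeaklyCrossFreeFam k F) (hSF : S ⊆ F) (T : Finset α)
    (hS : ∀ A ∈ S, A ⊆ T ∧ T.card = A.card + 1 ∧ 2 ≤ A.card) : S.card < k := by
  refine hF.card_lt hSF fun A hA B hB hne => ?_
  obtain ⟨hAT, hA1, hA2⟩ := hS A hA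
  obtain ⟨hBT, hB1, -⟩ := hS B hB
  refine weaklyCrossing_of_card_eq hne (by omega) (Finset.card_pos.1 ?_)
  have h1 := Finset.card_union_add_card_inter A B
  have h2 := Finset.card_le_card (Finset.union_subset hAT hBT)
  omega

theorem card_le_of_card_le_one {α : Type*} [DecidableEq α] {X : Finset α}
    {S : Finset (Finset α)} (hSX : ∀ A ∈ S, A ⊆ X) (hS : ∀ A ∈ S, A.card ≤ 1) :
    S.card ≤ X.card + 1 := by
  have hsub : S ⊆ insert ∅ (X.image fun x => {x}) := by
    intro A hA
    rcases A.eq_empty_or_nonempty with rfl | hne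
    · exact Finset.mem_insert_self _ _
    · obtain ⟨x, rfl⟩ := Finset.card_eq_one.1 (le_antisymm (hS A hA) hne.card_pos)
      exact Finset.mem_insert_of_mem
        (Finset.mem_image_of_mem _ (hSX _ hA (Finset.mem_singleton_self x)))
  exact (Finset.card_le_card hsub).trans
    ((Finset.card_insert_le _ _).trans (Nat.succ_le_succ Finset.card_image_le))

/-- If every weakly-`(k-1)`-cross-free family on a ground set of size `m ≥ 1` has at
most `c·m` members, then a weakly-`k`-cross-free family `F ⊆ 2^X` with `|X| = n ≥ 1`
has at most `k·c·n + k·n` exceptional sets. -/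
theorem card_exceptional_le {α : Type} [DecidableEq α]
    (k : ℕ) (hk : 3 ≤ k) (c : ℝ) (hc : 0 < c)
    (hbound : ∀ (β : Type) [DecidableEq β] (Y : Finset β) (G : Finset (Finset β)),
      1 ≤ Y.card → (∀ A ∈ G, A ⊆ Y) → WeaklyCrossFreeFam (k - 1) G →
      (G.card : ℝ) ≤ c * Y.card)
    (X : Finset α) (hn : 1 ≤ X.card)
    (F : Finset (Finset α)) (hFX : ∀ A ∈ F, A ⊆ X)
    (hF : WeaklyCrossFreeFam k F) :
    ((F.filter (fun A => ∃ x ∈ X \ A, ∃ y ∈ X \ A, x ≠ y ∧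
        insert x A ∈ F ∧ insert y A ∈ F)).card : ℝ) ≤
      k * c * X.card + k * X.card := by
  set E := F.filter (fun A => ∃ x ∈ X \ A, ∃ y ∈ X \ A, x ≠ y ∧
    insert x A ∈ F ∧ insert y A ∈ F) with hE
  have hEF : E ⊆ F := Finset.filter_subset _ _
  have hpair : ∀ A, ∃ N : Finset (Finset α), A ∈ E → N.card = 2 ∧
      ∀ T ∈ N, T ∈ F ∧ A ⊆ T ∧ T.card = A.card + 1 := by
    intro A
    by_cases hA : A ∈ E
    · obtain ⟨-, x, hx, y, hy, hxy, hxF, hyF⟩ := Finset.mem_filter.1 hA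
      have hxA := (Finset.mem_sdiff.1 hx).2
      have hyA := (Finset.mem_sdiff.1 hy).2
      refine ⟨{insert x A, insert y A}, fun _ => ⟨Finset.card_pair fun h => ?_, ?_⟩⟩
      · have : x ∈ insert y A := h ▸ Finset.mem_insert_self x A
        exact (Finset.mem_insert.1 this).elim hxy hxA
      · intro T hT
        rcases Finset.mem_insert.1 hT with rfl | hT
        · exact ⟨hxF, Finset.subset_insert _ _, Finset.card_insert_of_notMem hxA⟩
        · obtain rfl := Finset.mem_singleton.1 hT
          exact ⟨hyF, Finset.subset_insert _ _, Finset.card_insert_of_notMem hyA⟩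
    · exact ⟨∅, fun h => absurd h hA⟩
  choose N hN using hpair
  set L := E.filter (fun A => 2 ≤ A.card) with hL
  have hLE : L ⊆ E := Finset.filter_subset _ _
  obtain ⟨G, hGL, hforest, hLG⟩ := exists_forest_of_degree_le L N k
    (fun A hA => (hN A (hLE hA)).1) fun T =>
      (hF.card_lt_of_shadow
        (((Finset.filter_subset _ _).trans hLE).trans hEF) T fun A hA => by
          obtain ⟨hAL, hTA⟩ := Finset.mem_filter.1 hA
          obtain ⟨-, h1, h2⟩ := (hN A (hLE hAL)).2 T hTA
          exact ⟨h1, h2, (Finset.mem_filter.1 hAL).2⟩).le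
  have hGE : G ⊆ E := hGL.trans hLE
  have hG : WeaklyCrossFreeFam (k - 1) G :=
    weaklyCrossFreeFam_pred (by omega) hF (hGE.trans hEF)
      (fun A hA => Finset.card_pos.1 (by have := (Finset.mem_filter.1 (hGL hA)).2; omega))
      N (fun A hA => (hN A (hGE hA)).2) hforest
  have hGc := hbound α X G hn (fun A hA => hFX A (hEF (hGE hA))) hG
  have hsmall : (E.filter (fun A => ¬ 2 ≤ A.card)).card ≤ X.card + 1 :=
    card_le_of_card_le_one (fun A hA => hFX A (hEF (Finset.filter_subset _ _ hA)))
      fun A hA => by have := (Finset.mem_filter.1 hA).2; omega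
  have hsplit := Finset.card_filter_add_card_filter_not (s := E) (fun A => 2 ≤ A.card)
  have hnat : E.card ≤ k * G.card + k * X.card := by
    have : X.card + 1 ≤ k * X.card := by nlinarith
    have hLf : (E.filter (fun A => 2 ≤ A.card)).card = L.card := rfl
    omega
  calc (E.card : ℝ) ≤ k * G.card + k * X.card := by exact_mod_cast hnat
    _ ≤ k * (c * X.card) + k * X.card := by gcongr
    _ = k * c * X.card + k * X.card := by ring
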